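/- The set B is nonempty if and only if R⁻ = ℝ or R⁺ = ℝ, in which case both equalities hold, the functions a and r are globally defined and bounded solutions of x' = h(t,x), and B = {(s,x₀) ∈ ℝ² : r(s) ≤ x₀ ≤ a(s)}. -/

import Mathlib

open Set Filter

/-- The family of maximal solutions `t ↦ X t s x₀` of the scalar ODE `x' = h (t, x)`. -/
structure MaxSolFamily (h : ℝ → ℝ → ℝ) where
  X : ℝ → ℝ → ℝ → ℝ
  dom : ℝ → ℝ → Set ℝ
  dom_open : ∀ s x₀, IsOpen (dom s x₀)
  dom_ordConn : ∀ s x₀, (dom s x₀).OrdConnected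
  mem_dom : ∀ s x₀, s ∈ dom s x₀
  init : ∀ s x₀, X s s x₀ = x₀
  sol : ∀ s x₀, ∀ t ∈ dom s x₀, HasDerivAt (fun τ => X τ s x₀) (h t (X t s x₀)) t
  maximal : ∀ s x₀ (y : ℝ → ℝ) (I : Set ℝ), IsOpen I → I.OrdConnected → s ∈ I →
      y s = x₀ → (∀ t ∈ I, HasDerivAt y (h t (y t)) t) →
      I ⊆ dom s x₀ ∧ ∀ t ∈ I, y t = X t s x₀

/-- `B⁻`: solutions bounded above in the past. -/
def Bminus {h : ℝ → ℝ → ℝ} (F : MaxSolFamily h) : Set (ℝ × ℝ) :=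
  {sx | BddAbove ((fun t => F.X t sx.1 sx.2) '' (F.dom sx.1 sx.2 ∩ Iic sx.1))}

/-- `B⁺`: solutions bounded below in the future. -/
def Bplus {h : ℝ → ℝ → ℝ} (F : MaxSolFamily h) : Set (ℝ × ℝ) :=
  {sx | BddBelow ((fun t => F.X t sx.1 sx.2) '' (F.dom sx.1 sx.2 ∩ Ici sx.1))}

def Rminus {h : ℝ → ℝ → ℝ} (F : MaxSolFamily h) : Set ℝ :=
  {s | ∃ x₀, (s, x₀) ∈ Bminus F}

def Rplus {h : ℝ → ℝ → ℝ} (F : MaxSolFamily h) : Set ℝ :=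
  {s | ∃ x₀, (s, x₀) ∈ Bplus F}

/-- The solution `X · s x₀` is (defined and) bounded as `t → −∞`. -/
def BddAtBot {h : ℝ → ℝ → ℝ} (F : MaxSolFamily h) (s x₀ : ℝ) : Prop :=
  ∃ C : ℝ, ∀ᶠ t in atBot, t ∈ F.dom s x₀ ∧ |F.X t s x₀| ≤ C

/-- The solution `X · s x₀` is (defined and) bounded as `t → ∞`. -/
def BddAtTop {h : ℝ → ℝ → ℝ} (F : MaxSolFamily h) (s x₀ : ℝ) : Prop :=
  ∃ C : ℝ, ∀ᶠ t in atTop, t ∈ F.dom s x₀ ∧ |F.X t s x₀| ≤ C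

/-- `a` is the globally defined bounded solution characterized by:
`X · s x₀` is bounded as `t → −∞` iff `x₀ ≤ a s`. -/
def CharA {h : ℝ → ℝ → ℝ} (F : MaxSolFamily h) (a : ℝ → ℝ) : Prop :=
  (∀ t, HasDerivAt a (h t (a t)) t) ∧ (∃ C, ∀ t, |a t| ≤ C) ∧
  ∀ s x₀ : ℝ, BddAtBot F s x₀ ↔ x₀ ≤ a s

/-- `r` is the globally defined bounded solution characterized by:
`X · s x₀` is bounded as `t → ∞` iff `x₀ ≥ r s`. -/
def CharR {h : ℝ → ℝ → ℝ} (F : MaxSolFamily h) (r : ℝ → ℝ) : Prop :=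
  (∀ t, HasDerivAt r (h t (r t)) t) ∧ (∃ C, ∀ t, |r t| ≤ C) ∧
  ∀ s x₀ : ℝ, BddAtTop F s x₀ ↔ r s ≤ x₀

open Topology

/-- The coercivity condition `h (t, x) ≤ -μ x²` for `|x| ≥ M`. -/
def CoerciveWith (h : ℝ → ℝ → ℝ) (μ M : ℝ) : Prop :=
  ∀ t x : ℝ, M ≤ |x| → h t x ≤ -μ * x ^ 2

/-- The right-hand side of the equation solved by `t ↦ -x (-t)` when `x` solves `x' = h (t, x)`. -/
def reflField (h : ℝ → ℝ → ℝ) : ℝ → ℝ → ℝ := fun t x => h (-t) (-x)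

theorem CoerciveWith.refl {h : ℝ → ℝ → ℝ} {μ M : ℝ} (H : CoerciveWith h μ M) :
    CoerciveWith (reflField h) μ M := by
  intro t x hx
  have := H (-t) (-x) (by rwa [abs_neg])
  simpa [reflField] using this

theorem hasDerivAt_reflection {h : ℝ → ℝ → ℝ} {y : ℝ → ℝ} {t : ℝ}
    (hy : HasDerivAt y (h (-t) (y (-t))) (-t)) :
    HasDerivAt (fun τ => -y (-τ)) (reflField h t (-y (-t))) t := by
  have := (hy.comp t (hasDerivAt_neg t)).neg
  simpa [reflField, Function.comp_def, Pi.neg_def] using this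

theorem hasDerivAt_of_reflField {h : ℝ → ℝ → ℝ} {y : ℝ → ℝ} {t : ℝ}
    (hy : HasDerivAt y (reflField h (-t) (y (-t))) (-t)) :
    HasDerivAt (fun τ => -y (-τ)) (h t (-y (-t))) t := by
  have := (hy.comp t (hasDerivAt_neg t)).neg
  simpa [reflField, Function.comp_def, Pi.neg_def] using this

theorem ordConnected_neg_preimage {I : Set ℝ} (hI : I.OrdConnected) :
    {t : ℝ | -t ∈ I}.OrdConnected := by
  refine ⟨fun x hx y hy z hz => ?_⟩
  exact hI.out hy hx ⟨neg_le_neg hz.2, neg_le_neg hz.1⟩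

/-- The family of maximal solutions of the reflected equation. -/
def MaxSolFamily.refl {h : ℝ → ℝ → ℝ} (F : MaxSolFamily h) : MaxSolFamily (reflField h) where
  X t s x := -F.X (-t) (-s) (-x)
  dom s x := {t | -t ∈ F.dom (-s) (-x)}
  dom_open s x := (F.dom_open (-s) (-x)).preimage continuous_neg
  dom_ordConn s x := ordConnected_neg_preimage (F.dom_ordConn (-s) (-x))
  mem_dom s x := F.mem_dom (-s) (-x)
  init s x := by simp [F.init]
  sol s x t ht := hasDerivAt_reflection (F.sol (-s) (-x) (-t) ht)
  maximal s x y I hI hI' hs hy hd := by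
    have key := F.maximal (-s) (-x) (fun τ => -y (-τ)) {t | -t ∈ I}
      (hI.preimage continuous_neg) (ordConnected_neg_preimage hI')
      (by simpa using hs) (by simp [hy])
      (fun t ht => hasDerivAt_of_reflField (hd (-t) ht))
    refine ⟨fun t ht => key.1 (by simpa using ht), fun t ht => ?_⟩
    have := key.2 (-t) (by simpa using ht)
    simp only [neg_neg] at this
    rw [← this, neg_neg]

section Barrier

variable {h : ℝ → ℝ → ℝ} {μ M : ℝ}

theorem CoerciveWith.le_of_le (H : CoerciveWith h μ M) (hμ : 0 < μ) (hM : 0 < M)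
    {y : ℝ → ℝ} {s t B : ℝ} (hst : s ≤ t) (hB : M ≤ |B|)
    (hy : ∀ τ ∈ Icc s t, HasDerivAt y (h τ (y τ)) τ) (hs : y s ≤ B) : y t ≤ B := by
  refine image_le_of_deriv_right_lt_deriv_boundary' (f := y) (f' := fun τ => h τ (y τ))
    (B := fun _ => B) (B' := fun _ => 0) (a := s) (b := t)
    (fun τ hτ => (hy τ hτ).continuousAt.continuousWithinAt)
    (fun τ hτ => (hy τ ⟨hτ.1, hτ.2.le⟩).hasDerivWithinAt) hs continuousOn_const
    (fun τ _ => hasDerivWithinAt_const _ _ _) (fun τ _ hB' => ?_) ⟨hst, le_rfl⟩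
  have hle := H τ (y τ) (by rw [hB']; exact hB)
  have hpos : 0 < y τ ^ 2 := by
    rw [hB', ← sq_abs]
    have : 0 < |B| := hM.trans_le hB
    positivity
  nlinarith [mul_pos hμ hpos]

theorem CoerciveWith.neg_le_of_neg_le (H : CoerciveWith h μ M) (hμ : 0 < μ) (hM : 0 < M)
    {y : ℝ → ℝ} {s t B : ℝ} (hst : s ≤ t) (hB : M ≤ B)
    (hy : ∀ τ ∈ Icc s t, HasDerivAt y (h τ (y τ)) τ) (ht : -B ≤ y t) : -B ≤ y s := by
  by_contra! hlt
  have hB0 : y s < 0 := by linarith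
  have := H.le_of_le hμ hM (B := y s) hst (by rw [abs_of_neg hB0]; linarith) hy le_rfl
  linarith

/-- A solution below `-M` blows up in finite time. -/
theorem CoerciveWith.neg_le_of_forall_ge (H : CoerciveWith h μ M) (hμ : 0 < μ) (hM : 0 < M)
    {y : ℝ → ℝ} {s : ℝ} (hy : ∀ τ, s ≤ τ → HasDerivAt y (h τ (y τ)) τ) : -M ≤ y s := by
  by_contra! hlt
  have hbar : ∀ t, s ≤ t → y t ≤ y s := fun t ht =>
    H.le_of_le hμ hM ht (by rw [abs_of_neg (by linarith)]; linarith)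
      (fun τ hτ => hy τ hτ.1) le_rfl
  have hneg : ∀ t, s ≤ t → y t < 0 := fun t ht => by linarith [hbar t ht]
  have hder : ∀ t, s ≤ t →
      HasDerivAt (fun τ => (y τ)⁻¹ - μ * τ) (-h t (y t) / y t ^ 2 - μ) t := fun t ht => by
    simpa [Pi.sub_def, Pi.inv_def] using
      ((hy t ht).inv (hneg t ht).ne).sub ((hasDerivAt_id t).const_mul μ)
  have hmono : MonotoneOn (fun τ => (y τ)⁻¹ - μ * τ) (Ici s) := by
    refine monotoneOn_of_deriv_nonneg (convex_Ici s)
      (fun t ht => (hder t ht).continuousAt.continuousWithinAt)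
      (fun t ht => ?_) (fun t ht => ?_)
    · rw [interior_Ici] at ht
      exact (hder t (le_of_lt ht)).differentiableAt.differentiableWithinAt
    · rw [interior_Ici] at ht
      have ht' : s ≤ t := le_of_lt ht
      rw [(hder t ht').deriv]
      have hle := H t (y t) (by
        rw [abs_of_neg (hneg t ht')]; linarith [hbar t ht'])
      have hsq : 0 < y t ^ 2 := by have := (hneg t ht').ne; positivity
      have : μ ≤ -h t (y t) / y t ^ 2 := by
        rw [le_div_iff₀ hsq]; linarith
      linarith
  have hys : (y s)⁻¹ < 0 := inv_lt_zero.2 (hneg s le_rfl)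
  have hT : s ≤ s - (y s)⁻¹ / μ := by
    have : (y s)⁻¹ / μ < 0 := div_neg_of_neg_of_pos hys hμ
    linarith
  have h1 := hmono (mem_Ici.2 le_rfl) (mem_Ici.2 hT) hT
  have h2 : (y (s - (y s)⁻¹ / μ))⁻¹ < 0 := inv_lt_zero.2 (hneg _ hT)
  simp only at h1
  have h3 : μ * (s - (y s)⁻¹ / μ) = μ * s - (y s)⁻¹ := by field_simp
  linarith

end Barrier

namespace MaxSolFamily

variable {h : ℝ → ℝ → ℝ} (F : MaxSolFamily h)

theorem cocycle {s x t : ℝ} (ht : t ∈ F.dom s x) :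
    F.dom s x ⊆ F.dom t (F.X t s x) ∧ ∀ τ ∈ F.dom s x, F.X τ s x = F.X τ t (F.X t s x) :=
  F.maximal t (F.X t s x) (fun τ => F.X τ s x) (F.dom s x) (F.dom_open s x)
    (F.dom_ordConn s x) ht rfl (F.sol s x)

theorem Icc_subset_dom {s x t u : ℝ} (ht : t ∈ F.dom s x) (hu : u ∈ F.dom s x) :
    Icc t u ⊆ F.dom s x := (F.dom_ordConn s x).out ht hu

/-- Distinct solutions never cross. -/
theorem lt_of_lt {s x s' x' t u : ℝ} (ht : t ∈ F.dom s x) (ht' : t ∈ F.dom s' x')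
    (hu : u ∈ F.dom s x) (hu' : u ∈ F.dom s' x') (hlt : F.X t s x < F.X t s' x') :
    F.X u s x < F.X u s' x' := by
  by_contra! hle
  set I := F.dom s x ∩ F.dom s' x'
  have hIo : IsOpen I := (F.dom_open s x).inter (F.dom_open s' x')
  have hIc : I.OrdConnected := (F.dom_ordConn s x).inter (F.dom_ordConn s' x')
  have hc : ContinuousOn (fun τ => F.X τ s x - F.X τ s' x') I := fun τ hτ =>
    ((F.sol s x τ hτ.1).continuousAt.sub (F.sol s' x' τ hτ.2).continuousAt).continuousWithinAt
  obtain ⟨τ, hτ, h0⟩ := hIc.isPreconnected.intermediate_value ⟨ht, ht'⟩ ⟨hu, hu'⟩ hc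
    (show (0 : ℝ) ∈ Icc _ _ from ⟨sub_nonpos.2 hlt.le, sub_nonneg.2 hle⟩)
  have heq : F.X τ s x = F.X τ s' x' := sub_eq_zero.1 h0
  have h1 := (F.cocycle hτ.1).2 t ht
  have h2 := (F.cocycle hτ.2).2 t ht'
  rw [heq, ← h2] at h1
  exact hlt.ne h1

/-- A solution that stays bounded can be continued to the left. -/
theorem mem_dom_of_bounded_left (hcont : Continuous fun q : ℝ × ℝ => h q.1 q.2)
    {s x t₁ C : ℝ} (hts : t₁ ≤ s)
    (hC : ∀ t ∈ F.dom s x, t₁ ≤ t → t ≤ s → |F.X t s x| ≤ C) : t₁ ∈ F.dom s x := by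
  by_contra ht₁
  set A := F.dom s x ∩ Ici t₁
  have hAne : A.Nonempty := ⟨s, F.mem_dom s x, hts⟩
  have hAbdd : BddBelow A := ⟨t₁, fun t ht => ht.2⟩
  set α := sInf A
  have htα : t₁ ≤ α := le_csInf hAne fun t ht => ht.2
  have hα_dom : α ∉ F.dom s x := fun hmem => by
    have hlt : t₁ < α := htα.lt_of_ne fun heq => ht₁ (heq ▸ hmem)
    obtain ⟨l, hl, hl'⟩ := exists_Ioc_subset_of_mem_nhds ((F.dom_open s x).mem_nhds hmem)
      ⟨t₁, hlt⟩
    obtain ⟨c, hc1, hc2⟩ := exists_between (max_lt hl hlt)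
    have : α ≤ c := csInf_le hAbdd
      ⟨hl' ⟨(le_max_left _ _).trans_lt hc1, hc2.le⟩, ((le_max_right _ _).trans_lt hc1).le⟩
    linarith
  have hαs : α < s := (csInf_le hAbdd ⟨F.mem_dom s x, hts⟩).lt_of_ne fun heq =>
    hα_dom (heq ▸ F.mem_dom s x)
  have hsub : Ioc α s ⊆ F.dom s x := fun t ht => by
    obtain ⟨c, hc, hct⟩ := exists_lt_of_csInf_lt hAne ht.1
    exact F.Icc_subset_dom hc.1 (F.mem_dom s x) ⟨hct.le, ht.2⟩
  obtain ⟨D, hD⟩ := ((isCompact_Icc (a := t₁) (b := s)).prod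
    (isCompact_Icc (a := -C) (b := C))).exists_bound_of_continuousOn hcont.continuousOn
  have hbd : ∀ t ∈ Ioc α s, ‖h t (F.X t s x)‖ ≤ max D 0 := fun t ht =>
    (hD (t, F.X t s x) ⟨⟨htα.trans ht.1.le, ht.2⟩,
      abs_le.1 (hC t (hsub ht) (htα.trans ht.1.le) ht.2)⟩).trans (le_max_left _ _)
  have hLip : LipschitzOnWith (max D 0).toNNReal (fun τ => F.X τ s x) (Ioc α s) :=
    (convex_Ioc α s).lipschitzOnWith_of_nnnorm_hasDerivWithin_le
      (fun t ht => (F.sol s x t (hsub ht)).hasDerivWithinAt)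
      (fun t ht => by
        rw [← NNReal.coe_le_coe, coe_nnnorm, Real.coe_toNNReal _ (le_max_right _ _)]
        exact hbd t ht)
  obtain ⟨g, hg, hfg⟩ := hLip.extend_real
  obtain ⟨ε, hε, hεsub⟩ := Metric.isOpen_iff.1 (F.dom_open α (g α)) α (F.mem_dom α (g α))
  obtain ⟨δ, hδ, hδsub⟩ := Metric.isOpen_iff.1 (F.dom_open s x) s (F.mem_dom s x)
  rw [Real.ball_eq_Ioo] at hεsub hδsub
  have hright : Ioo α (s + δ) ⊆ F.dom s x := fun t ht => by
    rcases le_or_gt t s with hle | hgt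
    · exact hsub ⟨ht.1, hle⟩
    · exact hδsub ⟨by linarith, ht.2⟩
  set z : ℝ → ℝ := fun t => if t ≤ α then F.X t α (g α) else F.X t s x with hz
  have hzα : z α = g α := by simp [hz, F.init]
  have hz_right : ∀ t, α < t → z =ᶠ[𝓝 t] fun τ => F.X τ s x := fun t ht => by
    filter_upwards [Ioi_mem_nhds ht] with τ hτ
    simp [hz, not_le.2 (mem_Ioi.1 hτ)]
  have hsol_right : ∀ t ∈ Ioo α (s + δ), HasDerivAt z (h t (z t)) t := fun t ht => by
    rw [(hz_right t ht.1).self_of_nhds]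
    exact (F.sol s x t (hright ht)).congr_of_eventuallyEq (hz_right t ht.1)
  have hz_g : ∀ t ∈ Icc α s, z t = g t := fun t ht => by
    rcases ht.1.eq_or_lt with heq | hlt
    · rw [← heq, hzα]
    · rw [(hz_right t hlt).self_of_nhds]; exact hfg ⟨hlt, ht.2⟩
  have hderiv_α : HasDerivAt z (h α (z α)) α := by
    have hL : HasDerivWithinAt z (h α (z α)) (Iic α) α := by
      have := F.sol α (g α) α (F.mem_dom α (g α))
      rw [F.init, ← hzα] at this
      refine this.hasDerivWithinAt.congr (fun t ht => ?_) ?_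
      · simp only [hzα]; simp [hz, mem_Iic.1 ht]
      · simp only [hzα]; simp [F.init]
    have hR : HasDerivWithinAt z (h α (z α)) (Ici α) α := by
      refine hasDerivWithinAt_Ici_of_tendsto_deriv (s := Ioo α s)
        (fun t ht => (hsol_right t ⟨ht.1, by linarith [ht.2]⟩).differentiableAt
          |>.differentiableWithinAt) ?_ (Ioo_mem_nhdsGT hαs) ?_
      · exact (hg.continuous.continuousWithinAt).congr
          (fun t ht => hz_g t ⟨ht.1.le, ht.2.le⟩) hzα
      · have hlim : Tendsto (fun t => h t (g t)) (𝓝[>] α) (𝓝 (h α (g α))) :=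
          ((hcont.comp (continuous_id.prodMk hg.continuous)).tendsto α).mono_left
            nhdsWithin_le_nhds
        rw [hzα]
        refine hlim.congr' ?_
        filter_upwards [Ioo_mem_nhdsGT hαs] with t ht
        rw [(hsol_right t ⟨ht.1, by linarith [ht.2]⟩).deriv, hz_g t ⟨ht.1.le, ht.2.le⟩]
    have := hL.union hR
    rwa [Iic_union_Ici, hasDerivWithinAt_univ] at this
  refine hα_dom ((F.maximal s x z (Ioo (α - ε) (s + δ)) isOpen_Ioo ordConnected_Ioo
    ⟨by linarith, by linarith⟩ ?_ fun t ht => ?_).1 ⟨by linarith, by linarith⟩)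
  · exact (hz_right s hαs).self_of_nhds.trans (F.init s x)
  · rcases lt_trichotomy t α with hlt | heq | hgt
    · have hev : z =ᶠ[𝓝 t] fun τ => F.X τ α (g α) := by
        filter_upwards [Iio_mem_nhds hlt] with τ hτ
        simp [hz, (mem_Iio.1 hτ).le]
      rw [hev.self_of_nhds]
      exact (F.sol α (g α) t (hεsub ⟨ht.1, by linarith⟩)).congr_of_eventuallyEq hev
    · rw [heq]; exact hderiv_α
    · exact hsol_right t ⟨hgt, ht.2⟩

/-- A solution that stays bounded can be continued to the right. -/
theorem mem_dom_of_bounded_right (hcont : Continuous fun q : ℝ × ℝ => h q.1 q.2)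
    {s x t₁ C : ℝ} (hts : s ≤ t₁)
    (hC : ∀ t ∈ F.dom s x, s ≤ t → t ≤ t₁ → |F.X t s x| ≤ C) : t₁ ∈ F.dom s x := by
  have := F.refl.mem_dom_of_bounded_left (s := -s) (x := -x) (t₁ := -t₁) (C := C)
    (hcont.comp (continuous_fst.neg.prodMk continuous_snd.neg)) (neg_le_neg hts)
    (fun t ht h1 h2 => by
      have ht' : -t ∈ F.dom s x := by simpa [refl] using ht
      simpa [refl] using hC (-t) ht' (by linarith) (by linarith))
  simpa [refl] using this

variable {F} {μ M : ℝ}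

theorem neg_le_of_Ici_subset (H : CoerciveWith h μ M) (hμ : 0 < μ) (hM : 0 < M) {s x t : ℝ}
    (hP : Ici s ⊆ F.dom s x) (ht : s ≤ t) : -M ≤ F.X t s x :=
  H.neg_le_of_forall_ge hμ hM (y := fun τ => F.X τ s x) fun τ hτ =>
    F.sol s x τ (hP (ht.trans hτ))

theorem le_of_Iic_subset (H : CoerciveWith h μ M) (hμ : 0 < μ) (hM : 0 < M) {s x t : ℝ}
    (hP : Iic s ⊆ F.dom s x) (ht : t ≤ s) : F.X t s x ≤ M := by
  have := neg_le_of_Ici_subset (F := F.refl) H.refl hμ hM (s := -s) (x := -x) (t := -t)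
    (fun τ hτ => by
      have : -τ ∈ F.dom s x := hP (by simp only [mem_Ici, mem_Iic] at *; linarith)
      simpa [refl] using this) (neg_le_neg ht)
  simpa [refl] using this

theorem le_X_of_le (H : CoerciveWith h μ M) (hμ : 0 < μ) (hM : 0 < M) {s x t : ℝ}
    (ht : t ∈ F.dom s x) (hts : t ≤ s) : -max |x| M ≤ F.X t s x := by
  refine H.neg_le_of_neg_le hμ hM (y := fun τ => F.X τ s x) hts (le_max_right _ _)
    (fun τ hτ => F.sol s x τ (F.Icc_subset_dom ht (F.mem_dom s x) hτ)) ?_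
  simp only [F.init]
  linarith [neg_abs_le x, le_max_left |x| M]

theorem X_le_of_ge (H : CoerciveWith h μ M) (hμ : 0 < μ) (hM : 0 < M) {s x t : ℝ}
    (ht : t ∈ F.dom s x) (hst : s ≤ t) : F.X t s x ≤ max |x| M := by
  refine H.le_of_le hμ hM (y := fun τ => F.X τ s x) hst ((le_max_right _ _).trans (le_abs_self _))
    (fun τ hτ => F.sol s x τ (F.Icc_subset_dom (F.mem_dom s x) ht hτ)) ?_
  simp only [F.init]
  exact (le_abs_self x).trans (le_max_left _ _)

theorem Iic_subset_of_forall_le (hcont : Continuous fun q : ℝ × ℝ => h q.1 q.2)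
    (H : CoerciveWith h μ M) (hμ : 0 < μ) (hM : 0 < M) {s x C : ℝ}
    (hC : ∀ t ∈ F.dom s x, t ≤ s → F.X t s x ≤ C) : Iic s ⊆ F.dom s x := fun _ ht₁ =>
  F.mem_dom_of_bounded_left hcont ht₁ (C := max C (max |x| M)) fun t ht _ hts =>
    abs_le.2 ⟨by linarith [le_X_of_le H hμ hM ht hts, le_max_right C (max |x| M)],
      (hC t ht hts).trans (le_max_left _ _)⟩

theorem mem_Bminus_iff (hcont : Continuous fun q : ℝ × ℝ => h q.1 q.2)
    (H : CoerciveWith h μ M) (hμ : 0 < μ) (hM : 0 < M) {s x : ℝ} :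
    (s, x) ∈ Bminus F ↔ Iic s ⊆ F.dom s x := by
  constructor
  · rintro ⟨C, hC⟩
    exact Iic_subset_of_forall_le hcont H hμ hM fun t ht hts => hC ⟨t, ⟨ht, hts⟩, rfl⟩
  · rintro hP
    refine ⟨M, ?_⟩
    rintro _ ⟨t, ht, rfl⟩
    exact le_of_Iic_subset H hμ hM hP ht.2

theorem bddAtBot_iff (H : CoerciveWith h μ M) (hμ : 0 < μ) (hM : 0 < M) {s x : ℝ} :
    BddAtBot F s x ↔ Iic s ⊆ F.dom s x := by
  constructor
  · rintro ⟨C, hC⟩ t ht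
    obtain ⟨u, hu, hut⟩ := (hC.and (eventually_le_atBot t)).exists
    exact F.Icc_subset_dom hu.1 (F.mem_dom s x) ⟨hut, ht⟩
  · intro hP
    refine ⟨max |x| M, ?_⟩
    filter_upwards [eventually_le_atBot s] with t ht
    exact ⟨hP ht, abs_le.2 ⟨le_X_of_le H hμ hM (hP ht) ht,
      (le_of_Iic_subset H hμ hM hP ht).trans (le_max_right _ _)⟩⟩

theorem refl_Iic_subset_iff {s x : ℝ} :
    Iic s ⊆ F.refl.dom s x ↔ Ici (-s) ⊆ F.dom (-s) (-x) := by
  constructor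
  · intro hP t ht
    have : -t ∈ F.refl.dom s x := hP (by simp only [mem_Ici, mem_Iic] at *; linarith)
    simpa [refl] using this
  · intro hP t ht
    exact hP (by simp only [mem_Ici, mem_Iic] at *; linarith)

theorem mem_Bplus_iff (hcont : Continuous fun q : ℝ × ℝ => h q.1 q.2)
    (H : CoerciveWith h μ M) (hμ : 0 < μ) (hM : 0 < M) {s x : ℝ} :
    (s, x) ∈ Bplus F ↔ Ici s ⊆ F.dom s x := by
  constructor
  · rintro ⟨C, hC⟩ t₁ ht₁
    refine F.mem_dom_of_bounded_right hcont ht₁ (C := max (-C) (max |x| M))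
      fun t ht hst _ => abs_le.2 ⟨?_, (X_le_of_ge H hμ hM ht hst).trans (le_max_right _ _)⟩
    have : C ≤ F.X t s x := hC ⟨t, ⟨ht, hst⟩, rfl⟩
    linarith [le_max_left (-C) (max |x| M)]
  · rintro hP
    refine ⟨-M, ?_⟩
    rintro _ ⟨t, ht, rfl⟩
    exact neg_le_of_Ici_subset H hμ hM hP ht.2

theorem bddAtTop_iff (H : CoerciveWith h μ M) (hμ : 0 < μ) (hM : 0 < M) {s x : ℝ} :
    BddAtTop F s x ↔ Ici s ⊆ F.dom s x := by
  constructor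
  · rintro ⟨C, hC⟩ t ht
    obtain ⟨u, hu, htu⟩ := (hC.and (eventually_ge_atTop t)).exists
    exact F.Icc_subset_dom (F.mem_dom s x) hu.1 ⟨ht, htu⟩
  · intro hP
    refine ⟨max |x| M, ?_⟩
    filter_upwards [eventually_ge_atTop s] with t ht
    exact ⟨hP ht, abs_le.2 ⟨by
      linarith [neg_le_of_Ici_subset H hμ hM hP ht, le_max_right |x| M],
      X_le_of_ge H hμ hM (hP ht) ht⟩⟩

theorem Iic_subset_of_lt (hcont : Continuous fun q : ℝ × ℝ => h q.1 q.2)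
    (H : CoerciveWith h μ M) (hμ : 0 < μ) (hM : 0 < M) {s x x' : ℝ}
    (hlt : x < x') (hP : Iic s ⊆ F.dom s x') : Iic s ⊆ F.dom s x :=
  Iic_subset_of_forall_le hcont H hμ hM (C := M) fun t ht hts =>
    (F.lt_of_lt (F.mem_dom s x) (F.mem_dom s x') ht (hP hts)
      (by rwa [F.init, F.init])).le.trans (le_of_Iic_subset H hμ hM hP hts)

/-- A solution starting above a solution that is defined up to time `s` is defined up to
time `s`. -/
theorem mem_dom_of_lt (hcont : Continuous fun q : ℝ × ℝ => h q.1 q.2)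
    (H : CoerciveWith h μ M) (hμ : 0 < μ) (hM : 0 < M) {s b t x : ℝ} (hts : t ≤ s)
    (ht : t ∈ F.dom s b) (hlt : F.X t s b < x) : s ∈ F.dom t x := by
  refine F.mem_dom_of_bounded_right hcont hts (C := max (max |b| M) (max |x| M))
    fun τ hτ h1 h2 => abs_le.2 ⟨?_, (X_le_of_ge H hμ hM hτ h1).trans (le_max_right _ _)⟩
  have hτ' : τ ∈ F.dom s b := F.Icc_subset_dom ht (F.mem_dom s b) ⟨h1, h2⟩
  have := F.lt_of_lt ht (F.mem_dom t x) hτ' hτ (by rwa [F.init])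
  linarith [le_X_of_le H hμ hM hτ' h2, le_max_left (max |b| M) (max |x| M)]

/-- If at every time some solution is defined in the whole past, then the initial data with this
property are those below a globally defined bounded solution. -/
theorem exists_upper_solution (hcont : Continuous fun q : ℝ × ℝ => h q.1 q.2)
    (H : CoerciveWith h μ M) (hμ : 0 < μ) (hM : 0 < M)
    (hne : ∀ s, ∃ x, Iic s ⊆ F.dom s x) :
    ∃ a : ℝ → ℝ, (∀ t, HasDerivAt a (h t (a t)) t) ∧ (∀ t, |a t| ≤ M) ∧
      ∀ s x, Iic s ⊆ F.dom s x ↔ x ≤ a s := by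
  set S : ℝ → Set ℝ := fun s => {x | Iic s ⊆ F.dom s x}
  have hSle : ∀ s, ∀ x ∈ S s, x ≤ M := fun s x hx => by
    simpa [F.init] using le_of_Iic_subset H hμ hM hx (le_refl s)
  have hSbdd : ∀ s, BddAbove (S s) := fun s => ⟨M, hSle s⟩
  set a : ℝ → ℝ := fun s => sSup (S s)
  have hlt_mem : ∀ s x, x < a s → x ∈ S s := fun s x hx => by
    obtain ⟨x', hx', hxx'⟩ := exists_lt_of_lt_csSup (hne s) hx
    exact Iic_subset_of_lt hcont H hμ hM hxx' hx'
  have hmem : ∀ s, a s ∈ S s := fun s => by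
    by_contra hnot
    refine hnot (Iic_subset_of_forall_le hcont H hμ hM (C := M) fun t ht hts => ?_)
    by_contra! hgt
    obtain ⟨m, hMm, hm⟩ := exists_between hgt
    obtain ⟨b, hb⟩ := hne s
    have hmdom : s ∈ F.dom t m := mem_dom_of_lt hcont H hμ hM hts (hb hts)
      ((le_of_Iic_subset H hμ hM hb hts).trans_lt hMm)
    have hlt : F.X s t m < a s := by
      have := F.lt_of_lt (F.mem_dom t m) ht hmdom (F.mem_dom s (a s)) (by rwa [F.init])
      rwa [F.init] at this
    have hle := le_of_Iic_subset H hμ hM (hlt_mem s _ hlt) hts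
    rw [← (F.cocycle hmdom).2 t (F.mem_dom t m), F.init] at hle
    linarith
  have hiff : ∀ s x, Iic s ⊆ F.dom s x ↔ x ≤ a s := fun s x =>
    ⟨fun hx => le_csSup (hSbdd s) hx, fun hx => by
      rcases hx.eq_or_lt with heq | hlt
      · rw [heq]; exact hmem s
      · exact hlt_mem s x hlt⟩
  have hflow : ∀ s t, t ≤ s → F.X t s (a s) = a t := fun s t hts => by
    have htd : t ∈ F.dom s (a s) := hmem s hts
    have hle : F.X t s (a s) ≤ a t := (hiff t _).1 fun τ hτ =>
      (F.cocycle htd).1 (hmem s (le_trans hτ hts))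
    by_contra hneq
    have hlt := hle.lt_of_ne hneq
    have hsd : s ∈ F.dom t (a t) := mem_dom_of_lt hcont H hμ hM hts htd hlt
    have h1 := F.lt_of_lt htd (F.mem_dom t (a t)) (F.mem_dom s (a s)) hsd (by rwa [F.init])
    rw [F.init] at h1
    refine h1.not_ge ((hiff s _).1 fun τ hτ => (F.cocycle hsd).1 ?_)
    rcases le_total τ t with hτt | htτ
    · exact hmem t hτt
    · exact F.Icc_subset_dom (F.mem_dom t (a t)) hsd ⟨htτ, hτ⟩
  have hsol : ∀ t, HasDerivAt a (h t (a t)) t := fun t => by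
    have hev : a =ᶠ[𝓝 t] fun τ => F.X τ (t + 1) (a (t + 1)) := by
      filter_upwards [Iio_mem_nhds (lt_add_one t)] with τ hτ
      exact (hflow (t + 1) τ (mem_Iio.1 hτ).le).symm
    have := F.sol (t + 1) (a (t + 1)) t (hmem (t + 1) (lt_add_one t).le)
    rw [hflow (t + 1) t (lt_add_one t).le] at this
    exact this.congr_of_eventuallyEq hev
  exact ⟨a, hsol, fun t => abs_le.2 ⟨H.neg_le_of_forall_ge hμ hM fun τ _ => hsol τ,
    hSle t _ (hmem t)⟩, hiff⟩

/-- If at every time some solution is defined in the whole future, then the initial data with this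
property are those above a globally defined bounded solution. -/
theorem exists_lower_solution (hcont : Continuous fun q : ℝ × ℝ => h q.1 q.2)
    (H : CoerciveWith h μ M) (hμ : 0 < μ) (hM : 0 < M)
    (hne : ∀ s, ∃ x, Ici s ⊆ F.dom s x) :
    ∃ r : ℝ → ℝ, (∀ t, HasDerivAt r (h t (r t)) t) ∧ (∀ t, |r t| ≤ M) ∧
      ∀ s x, Ici s ⊆ F.dom s x ↔ r s ≤ x := by
  obtain ⟨a, hsol, hbd, hiff⟩ := exists_upper_solution (F := F.refl)
    (hcont.comp (continuous_fst.neg.prodMk continuous_snd.neg)) H.refl hμ hM (fun s => by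
      obtain ⟨x, hx⟩ := hne (-s)
      exact ⟨-x, refl_Iic_subset_iff.2 (by rwa [neg_neg])⟩)
  refine ⟨fun t => -a (-t), fun t => hasDerivAt_of_reflField (hsol (-t)),
    fun t => by rw [abs_neg]; exact hbd (-t), fun s x => ?_⟩
  have := hiff (-s) (-x)
  rw [refl_Iic_subset_iff, neg_neg, neg_neg] at this
  rw [this]
  exact neg_le

theorem dom_eq_univ_of_solution {y : ℝ → ℝ} (hy : ∀ t, HasDerivAt y (h t (y t)) t) (s : ℝ) :
    F.dom s (y s) = univ :=
  univ_subset_iff.1 (F.maximal s (y s) y univ isOpen_univ ordConnected_univ (mem_univ s) rfl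
    fun t _ => hy t).1

end MaxSolFamily

open MaxSolFamily

theorem stmt3 (h : ℝ → ℝ → ℝ)
    (hcont : Continuous fun q : ℝ × ℝ => h q.1 q.2)
    (hlip : ∀ q : ℝ × ℝ, ∃ K : ℝ, ∃ U ∈ nhds q, ∀ t x y : ℝ,
      (t, x) ∈ U → (t, y) ∈ U → |h t x - h t y| ≤ K * |x - y|)
    (hcoer : ∃ μ > (0:ℝ), ∃ M > (0:ℝ), ∀ t x : ℝ, M ≤ |x| → h t x ≤ -μ * x ^ 2)
    (F : MaxSolFamily h) :
    ((Bminus F ∩ Bplus F).Nonempty ↔ (Rminus F = Set.univ ∨ Rplus F = Set.univ)) ∧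
    ((Bminus F ∩ Bplus F).Nonempty →
      Rminus F = Set.univ ∧ Rplus F = Set.univ ∧
      ∃ a r : ℝ → ℝ, CharA F a ∧ CharR F r ∧
        Bminus F ∩ Bplus F = {sx : ℝ × ℝ | r sx.1 ≤ sx.2 ∧ sx.2 ≤ a sx.1}) := by
  obtain ⟨μ, hμ, M, hM, H⟩ := hcoer
  replace H : CoerciveWith h μ M := H
  have hRm : Rminus F = univ ↔ ∀ s, ∃ x, Iic s ⊆ F.dom s x := by
    simp only [eq_univ_iff_forall, Rminus, mem_ofPred_eq, mem_Bminus_iff hcont H hμ hM]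
  have hRp : Rplus F = univ ↔ ∀ s, ∃ x, Ici s ⊆ F.dom s x := by
    simp only [eq_univ_iff_forall, Rplus, mem_ofPred_eq, mem_Bplus_iff hcont H hμ hM]
  have hglobal : ∀ y : ℝ → ℝ, (∀ t, HasDerivAt y (h t (y t)) t) →
      (Bminus F ∩ Bplus F).Nonempty := fun y hy => by
    have hu := dom_eq_univ_of_solution (F := F) hy 0
    exact ⟨(0, y 0), (mem_Bminus_iff hcont H hμ hM).2 (by simp [hu]),
      (mem_Bplus_iff hcont H hμ hM).2 (by simp [hu])⟩
  have hR : (Bminus F ∩ Bplus F).Nonempty → Rminus F = univ ∧ Rplus F = univ := by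
    rintro ⟨⟨s, x⟩, hm, hp⟩
    have hm' := (mem_Bminus_iff hcont H hμ hM).1 hm
    have hp' := (mem_Bplus_iff hcont H hμ hM).1 hp
    have hu : ∀ t, t ∈ F.dom s x := fun t => (le_total t s).elim (fun ht => hm' ht)
      fun ht => hp' ht
    rw [hRm, hRp]
    exact ⟨fun t => ⟨F.X t s x, fun τ _ => (F.cocycle (hu t)).1 (hu τ)⟩,
      fun t => ⟨F.X t s x, fun τ _ => (F.cocycle (hu t)).1 (hu τ)⟩⟩
  refine ⟨⟨fun hB => Or.inl (hR hB).1, ?_⟩, fun hB => ⟨(hR hB).1, (hR hB).2, ?_⟩⟩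
  · rintro (hm | hp)
    · obtain ⟨a, ha, -⟩ := exists_upper_solution hcont H hμ hM (hRm.1 hm)
      exact hglobal a ha
    · obtain ⟨r, hr, -⟩ := exists_lower_solution hcont H hμ hM (hRp.1 hp)
      exact hglobal r hr
  · obtain ⟨a, ha, habd, haiff⟩ := exists_upper_solution hcont H hμ hM (hRm.1 (hR hB).1)
    obtain ⟨r, hr, hrbd, hriff⟩ := exists_lower_solution hcont H hμ hM (hRp.1 (hR hB).2)
    refine ⟨a, r, ⟨ha, ⟨M, habd⟩, fun s x => (bddAtBot_iff H hμ hM).trans (haiff s x)⟩,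
      ⟨hr, ⟨M, hrbd⟩, fun s x => (bddAtTop_iff H hμ hM).trans (hriff s x)⟩, ?_⟩
    ext ⟨s, x⟩
    rw [mem_inter_iff, mem_Bminus_iff hcont H hμ hM, mem_Bplus_iff hcont H hμ hM, haiff, hriff]
    exact and_comm
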